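/- Let π be a standard polynomial product weight on T^d with exponents 0 ≤ s_j < 1. For a compact set E ⊆ T̄^d define its boundary projection S_b(E) = ∪_{β ∈ E} ∂S(β) ⊆ (∂T)^d. Then cap_π S_b(E) ≤ cap_π E, and there is a constant C > 1 depending only on d and s_1, …, s_d such that cap_π E ≤ C · cap_π S_b(E). -/

import Mathlib

open MeasureTheory ENNReal Set
open scoped Classical

noncomputable section

/-- Vertices of the dyadic tree `T`: finite binary strings, rooted at the empty string. -/
abbrev TreeV : Type := List Bool

/-- The boundary `∂T`: infinite binary sequences. -/
abbrev TreeB : Type := ℕ → Bool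

/-- The closure `T̄ = T ∪ ∂T`. -/
abbrev TreeBar : Type := TreeV ⊕ TreeB

/-- Every subset of the (countable) vertex set is Borel. -/
instance : MeasurableSpace TreeV := ⊤

/-- `ancOf α β` means `α ≤ β` in `T̄`: `β` is an ancestor (initial segment) of `α`, or `α = β`. -/
def ancOf : TreeBar → TreeBar → Prop
  | Sum.inl a, Sum.inl b => b <+: a
  | Sum.inr ω, Sum.inl b => ∀ i : Fin b.length, b.get i = ω i
  | Sum.inl _, Sum.inr _ => False
  | Sum.inr ω, Sum.inr ω' => ω = ω'

/-- `d_T(a)`: the number of ancestors of the vertex `a` in `T`, including itself. -/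
def dT (a : TreeV) : ℕ := a.length + 1

/-- Vertices of the `d`-tree `T^d`. -/
abbrev VtxD (d : ℕ) : Type := Fin d → TreeV

/-- `T̄^d`. -/
abbrev BarD (d : ℕ) : Type := Fin d → TreeBar

/-- The distinguished boundary `(∂T)^d`. -/
abbrev BndD (d : ℕ) : Type := Fin d → TreeB

/-- Embedding of `T^d` into `T̄^d`. -/
def vEmb {d : ℕ} (α : VtxD d) : BarD d := fun i => Sum.inl (α i)

/-- Embedding of `(∂T)^d` into `T̄^d`. -/
def bEmb {d : ℕ} (ω : BndD d) : BarD d := fun i => Sum.inr (ω i)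

/-- `γ ≤ β`, for `γ ∈ T̄^d` and a vertex `β ∈ T^d` (componentwise order). -/
def vleOf {d : ℕ} (γ : BarD d) (β : VtxD d) : Prop := ∀ i, ancOf (γ i) (Sum.inl (β i))

/-- The successor set `S(β) ⊆ T̄^d` of a vertex `β ∈ T^d`. -/
def succSet {d : ℕ} (β : VtxD d) : Set (BarD d) := {γ | vleOf γ β}

/-- The boundary successor set `∂S(β)`, viewed as a subset of `(∂T)^d`. -/
def bSucc {d : ℕ} (β : VtxD d) : Set (BndD d) := {ω | vleOf (bEmb ω) β}

/-- One–variable successor set `S(b) ⊆ T̄`. -/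
def succ1 (b : TreeV) : Set TreeBar := {γ | ancOf γ (Sum.inl b)}

/-- One–variable boundary successor set `∂S(b) ⊆ ∂T`. -/
def bSucc1 (b : TreeV) : Set TreeB := {ω | ancOf (Sum.inr ω) (Sum.inl b)}

/-- The Hardy operator `(If)(α) = ∑_{β ∈ T^d, β ≥ α} f(β) π(β)` on `T^d`. -/
def hardy {d : ℕ} (π f : VtxD d → ℝ≥0∞) (α : BarD d) : ℝ≥0∞ :=
  ∑' β : VtxD d, Set.indicator {β : VtxD d | vleOf α β} (fun β => f β * π β) β

/-- The capacity `cap_π E` of a set `E ⊆ T̄^d`. -/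
def capac {d : ℕ} (π : VtxD d → ℝ≥0∞) (E : Set (BarD d)) : ℝ≥0∞ :=
  ⨅ (f : VtxD d → ℝ≥0∞) (_ : ∀ α ∈ E, 1 ≤ hardy π f α), ∑' β : VtxD d, f β ^ 2 * π β

/-- The potential `V_π^μ(α) = ∑_{β ∈ T^d, β ≥ α} μ(S(β)) π(β)` of a measure on `T̄^d`. -/
def potential {d : ℕ} (π : VtxD d → ℝ≥0∞) (μ : Measure (BarD d)) (α : BarD d) : ℝ≥0∞ :=
  ∑' β : VtxD d, Set.indicator {β : VtxD d | vleOf α β} (fun β => μ (succSet β) * π β) β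

/-- The energy `E_π[μ] = ∑_{β ∈ T^d} μ(S(β))² π(β)` of a measure on `T̄^d`. -/
def energy {d : ℕ} (π : VtxD d → ℝ≥0∞) (μ : Measure (BarD d)) : ℝ≥0∞ :=
  ∑' β : VtxD d, μ (succSet β) ^ 2 * π β

/-- The potential of a measure on the distinguished boundary `(∂T)^d`. -/
def potentialB {d : ℕ} (π : VtxD d → ℝ≥0∞) (μ : Measure (BndD d)) (α : BarD d) : ℝ≥0∞ :=
  ∑' β : VtxD d, Set.indicator {β : VtxD d | vleOf α β} (fun β => μ (bSucc β) * π β) β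

/-- The energy of a measure on the distinguished boundary `(∂T)^d`. -/
def energyB {d : ℕ} (π : VtxD d → ℝ≥0∞) (μ : Measure (BndD d)) : ℝ≥0∞ :=
  ∑' β : VtxD d, μ (bSucc β) ^ 2 * π β

/-- One–variable Hardy operator. -/
def hardy1 (π f : TreeV → ℝ≥0∞) (α : TreeBar) : ℝ≥0∞ :=
  ∑' b : TreeV, Set.indicator {b : TreeV | ancOf α (Sum.inl b)} (fun b => f b * π b) b

/-- One–variable capacity of `E ⊆ T̄`. -/
def capac1 (π : TreeV → ℝ≥0∞) (E : Set TreeBar) : ℝ≥0∞ :=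
  ⨅ (f : TreeV → ℝ≥0∞) (_ : ∀ α ∈ E, 1 ≤ hardy1 π f α), ∑' b : TreeV, f b ^ 2 * π b

/-- One–variable potential. -/
def potential1 (π : TreeV → ℝ≥0∞) (μ : Measure TreeBar) (α : TreeBar) : ℝ≥0∞ :=
  ∑' b : TreeV, Set.indicator {b : TreeV | ancOf α (Sum.inl b)} (fun b => μ (succ1 b) * π b) b

/-- One–variable energy. -/
def energy1 (π : TreeV → ℝ≥0∞) (μ : Measure TreeBar) : ℝ≥0∞ :=
  ∑' b : TreeV, μ (succ1 b) ^ 2 * π b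

/-- `d_π(α∧β) = ∑_{γ ∈ T^d, γ ≥ α, γ ≥ β} π(γ)`: the weighted count of common ancestors,
i.e. of the predecessors of the least common ancestor `α∧β`. -/
def dwedge {d : ℕ} (π : VtxD d → ℝ≥0∞) (α β : BarD d) : ℝ≥0∞ :=
  ∑' γ : VtxD d, Set.indicator {γ : VtxD d | vleOf α γ ∧ vleOf β γ} π γ

/-- One–variable `d_π(α∧β)`. -/
def dwedge1 (π : TreeV → ℝ≥0∞) (α β : TreeBar) : ℝ≥0∞ :=
  ∑' c : TreeV, Set.indicator {c : TreeV | ancOf α (Sum.inl c) ∧ ancOf β (Sum.inl c)} π c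

/-- The standard polynomial product weight `π(β) = ∏_j 2^{s_j d_T(β_j)}`. -/
def stdW (d : ℕ) (s : Fin d → ℝ) : VtxD d → ℝ≥0∞ :=
  fun β => ∏ j, (2 : ℝ≥0∞) ^ (s j * (dT (β j) : ℝ))

/-- The one–variable standard polynomial weight `π₁(γ) = 2^{s₁ d_T(γ)}`. -/
def stdW1 (s₁ : ℝ) : TreeV → ℝ≥0∞ := fun γ => (2 : ℝ≥0∞) ^ (s₁ * (dT γ : ℝ))

/-- `M` is the Borel measure on `∂T` determined by `M(∂S(a)) = 2^{-d_T(a)+1}` for all `a ∈ T`. -/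
def IsStdM (M : Measure TreeB) : Prop :=
  ∀ a : TreeV, M (bSucc1 a) = (2⁻¹ : ℝ≥0∞) ^ a.length

/-- `rho g τ` is the fraction of a unit mass placed at `τ ∈ T̄` that lands in `∂S(g)` when the
mass of every vertex is spread uniformly (w.r.t. `M`) over its boundary successor set, while
mass already on the boundary is kept in place. -/
def rho (g : TreeV) : TreeBar → ℝ≥0∞
  | Sum.inl b =>
      if g <+: b then 1 else if b <+: g then (2⁻¹ : ℝ≥0∞) ^ (g.length - b.length) else 0
  | Sum.inr ω => if ancOf (Sum.inr ω) (Sum.inl g) then 1 else 0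

/-- `IsBdryProj μ μb`: `μb` is the boundary projection of `μ`, characterised by its values on
the cylinders `∂S(γ)`, `γ ∈ T^d`. -/
def IsBdryProj {d : ℕ} (μ : Measure (BarD d)) (μb : Measure (BndD d)) : Prop :=
  ∀ γ : VtxD d, μb (bSucc γ) = ∫⁻ τ, ∏ j, rho (γ j) (τ j) ∂μ

/-- The set of points of `T̄^d` all of whose coordinates lie on the boundary `∂T`,
i.e. the distinguished boundary viewed inside `T̄^d`. -/
def bdryD (d : ℕ) : Set (BarD d) := {γ | ∀ i, ∃ ω : TreeB, γ i = Sum.inr ω}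

/-- The boundary projection `S_b(E) = ⋃_{β ∈ E} ∂S(β) ⊆ (∂T)^d` of `E ⊆ T̄^d`,
viewed inside `T̄^d`. -/
def sbProj {d : ℕ} (E : Set (BarD d)) : Set (BarD d) :=
  {γ | γ ∈ bdryD d ∧ ∃ β ∈ E, ∀ i, ancOf (γ i) (β i)}

/-- The maximal function `M_μ g (ω) = sup_{α ∈ T^d, α ≥ ω} (1/μ(∂S(α))) ∫_{∂S(α)} g dμ`. -/
def maxFn {d : ℕ} (μ : Measure (BndD d)) (g : BndD d → ℝ≥0∞) (ω : BndD d) : ℝ≥0∞ :=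
  ⨆ (α : VtxD d) (_ : ω ∈ bSucc α), (μ (bSucc α))⁻¹ * ∫⁻ x in bSucc α, g x ∂μ

/-- Embedding of `T̄` into `ℕ → Option Bool`, recording the binary digits. -/
def treeBarEmbed : TreeBar → (ℕ → Option Bool)
  | Sum.inl a => fun n => a[n]?
  | Sum.inr ω => fun n => some (ω n)

instance : TopologicalSpace (Option Bool) := ⊥

/-- The natural compact topology on `T̄`, induced by the metric `δ`; equivalently, the topology
induced from the product topology on `ℕ → Option Bool`. -/
instance : TopologicalSpace TreeBar := TopologicalSpace.induced treeBarEmbed inferInstance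

theorem ENNReal.tsum_pi_prod {X : Type*} :
    ∀ (d : ℕ) (a : Fin d → X → ℝ≥0∞), ∑' γ : Fin d → X, ∏ j, a j (γ j) = ∏ j, ∑' x, a j x
  | 0, a => by simp
  | d + 1, a => by
    rw [← (Fin.consEquiv fun _ : Fin (d + 1) => X).tsum_eq, ENNReal.tsum_prod']
    simp only [Fin.consEquiv, Equiv.coe_fn_mk, Fin.prod_univ_succ, Fin.cons_zero, Fin.cons_succ]
    simp_rw [ENNReal.tsum_mul_left, ENNReal.tsum_pi_prod d, ENNReal.tsum_mul_right]

/-- Cauchy–Schwarz for sums of extended nonnegative reals. -/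
theorem ENNReal.sq_tsum_le_of_sq_le_mul {ι : Type*} {x p q : ι → ℝ≥0∞}
    (h : ∀ i, x i ^ 2 ≤ p i * q i) : (∑' i, x i) ^ 2 ≤ (∑' i, p i) * ∑' i, q i := by
  let _ : MeasurableSpace ι := ⊤
  have key := ENNReal.lintegral_mul_le_Lp_mul_Lq (Measure.count : Measure ι)
    (Real.HolderConjugate.two_two) (f := fun i => p i ^ (1 / 2 : ℝ))
    (g := fun i => q i ^ (1 / 2 : ℝ)) (measurable_from_top.aemeasurable)
    (measurable_from_top.aemeasurable)
  simp only [lintegral_count, Pi.mul_apply, ← ENNReal.rpow_mul] at key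
  norm_num at key
  have h1 : ∑' i, x i ≤ ∑' i, p i ^ (1 / 2 : ℝ) * q i ^ (1 / 2 : ℝ) := by
    refine ENNReal.tsum_le_tsum fun i => ?_
    have := ENNReal.rpow_le_rpow (h i) (z := 1 / 2) (by norm_num)
    rw [ENNReal.mul_rpow_of_nonneg _ _ (by norm_num), ← ENNReal.rpow_natCast,
      ← ENNReal.rpow_mul] at this
    norm_num at this ⊢
    exact this
  have h2 := pow_le_pow_left₀ (zero_le) (h1.trans (by norm_num; exact key)) 2
  refine h2.trans (le_of_eq ?_)
  rw [mul_pow, ← ENNReal.rpow_natCast, ← ENNReal.rpow_natCast, ← ENNReal.rpow_mul,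
    ← ENNReal.rpow_mul]
  norm_num

/-- Schur's test for the positive kernel `K`, with weight `π` and test function `h`. -/
theorem ENNReal.schur_test {ι : Type*} (π h : ι → ℝ≥0∞) (K : ι → ι → ℝ≥0∞) (A B : ℝ≥0∞)
    (h0 : ∀ i, h i ≠ 0) (ht : ∀ i, h i ≠ ⊤)
    (hA : ∀ b, ∑' g, K b g * h g ≤ A * h b)
    (hB : ∀ g, ∑' b, K b g * (π b * h b) ≤ B * (π g * h g)) (f : ι → ℝ≥0∞) :
    ∑' b, (∑' g, K b g * f g) ^ 2 * π b ≤ A * B * ∑' g, f g ^ 2 * π g := by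
  calc ∑' b, (∑' g, K b g * f g) ^ 2 * π b
      ≤ ∑' b, (A * h b * ∑' g, K b g * (f g ^ 2 * (h g)⁻¹)) * π b := by
        refine ENNReal.tsum_le_tsum fun b => ?_
        gcongr
        refine (ENNReal.sq_tsum_le_of_sq_le_mul (p := fun g => K b g * h g)
          (q := fun g => K b g * (f g ^ 2 * (h g)⁻¹)) fun g => le_of_eq ?_).trans
          (mul_le_mul_left (hA b) _)
        calc (K b g * f g) ^ 2 = K b g * K b g * f g ^ 2 * (h g * (h g)⁻¹) := by
              rw [ENNReal.mul_inv_cancel (h0 g) (ht g)]; ring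
          _ = _ := by ring
    _ = ∑' g, A * (f g ^ 2 * (h g)⁻¹) * ∑' b, K b g * (π b * h b) := by
        simp_rw [← ENNReal.tsum_mul_left, ← ENNReal.tsum_mul_right]
        rw [ENNReal.tsum_comm]
        refine tsum_congr fun g => tsum_congr fun b => by ring
    _ ≤ ∑' g, A * (f g ^ 2 * (h g)⁻¹) * (B * (π g * h g)) := by
        refine ENNReal.tsum_le_tsum fun g => ?_
        gcongr
        exact hB g
    _ = A * B * ∑' g, f g ^ 2 * π g := by
        rw [← ENNReal.tsum_mul_left]
        refine tsum_congr fun g => ?_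
        calc _ = A * B * (f g ^ 2 * π g) * (h g * (h g)⁻¹) := by ring
          _ = _ := by rw [ENNReal.mul_inv_cancel (h0 g) (ht g), mul_one]

theorem two_rpow_add (x y : ℝ) : (2 : ℝ≥0∞) ^ (x + y) = 2 ^ x * 2 ^ y :=
  ENNReal.rpow_add x y (by norm_num) (by norm_num)

/-- The geometric sum `∑_n 2^{-tn}`. -/
def geomC (t : ℝ) : ℝ≥0∞ := ∑' n : ℕ, (2 : ℝ≥0∞) ^ (-t * n)

theorem geomC_ne_top {t : ℝ} (ht : 0 < t) : geomC t ≠ ⊤ := by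
  have h : ∀ n : ℕ, (2 : ℝ≥0∞) ^ (-t * n) = ((2 : ℝ≥0∞) ^ (-t)) ^ n := fun n => by
    rw [ENNReal.rpow_mul, ENNReal.rpow_natCast]
  rw [geomC, tsum_congr h, ENNReal.tsum_geometric, ENNReal.inv_ne_top]
  have : (2 : ℝ≥0∞) ^ (-t) < 1 :=
    ENNReal.rpow_lt_one_of_one_lt_of_neg (by norm_num) (by linarith)
  exact (tsub_pos_of_lt this).ne'

theorem tsum_length (φ : ℕ → ℝ≥0∞) : ∑' l : List Bool, φ l.length = ∑' n : ℕ, 2 ^ n * φ n := by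
  rw [← (Equiv.sigmaFiberEquiv (List.length : List Bool → ℕ)).tsum_eq, ENNReal.tsum_sigma']
  refine tsum_congr fun n => ?_
  have h : ∀ l : {l : List Bool // l.length = n},
      φ ((Equiv.sigmaFiberEquiv (List.length : List Bool → ℕ)) ⟨n, l⟩).length = φ n := by
    rintro ⟨l, rfl⟩; rfl
  rw [tsum_congr h]
  have hc : Fintype.card (List.Vector Bool n) = 2 ^ n := by simp [card_vector]
  change ∑' _ : List.Vector Bool n, φ n = _
  rw [tsum_fintype]
  simp

/-- The kernel of the one-variable averaging operator over descendants. -/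
def avgK (s : ℝ) (b g : TreeV) : ℝ≥0∞ :=
  if b <+: g then 2 ^ (-(1 - s) * ((g.length : ℝ) - b.length)) else 0

/-- The test function in Schur's test. -/
def testH (s : ℝ) (b : TreeV) : ℝ≥0∞ := 2 ^ (-((1 + s) / 2) * (b.length : ℝ))

theorem tsum_avgK_right (s : ℝ) (b : TreeV) :
    ∑' g, avgK s b g * testH s g ≤ geomC ((1 - s) / 2) * testH s b := by
  have hinj : Function.Injective (fun l : TreeV => b ++ l) := List.append_right_injective b
  rw [← hinj.tsum_eq]
  · have : ∀ l : TreeV, avgK s b (b ++ l) * testH s (b ++ l)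
        = 2 ^ ((-(1 - s) - (1 + s) / 2) * (l.length : ℝ)) * testH s b := fun l => by
      rw [avgK, if_pos (List.prefix_append b l), testH, testH, ← two_rpow_add, ← two_rpow_add]
      congr 1
      push_cast [List.length_append]
      ring
    rw [tsum_congr this, ENNReal.tsum_mul_right,
      tsum_length fun n => 2 ^ ((-(1 - s) - (1 + s) / 2) * (n : ℝ)), geomC]
    refine le_of_eq ?_
    congr 1
    refine tsum_congr fun n => ?_
    rw [← ENNReal.rpow_natCast, ← two_rpow_add]
    congr 1
    ring
  · intro g hg
    simp only [Function.mem_support, avgK] at hg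
    by_cases h : b <+: g
    · obtain ⟨l, rfl⟩ := h
      exact ⟨l, rfl⟩
    · simp [h] at hg

theorem tsum_avgK_left (s : ℝ) (g : TreeV) :
    ∑' b, avgK s b g * (stdW1 s b * testH s b)
      ≤ geomC ((1 - s) / 2) * (stdW1 s g * testH s g) := by
  have h1 : ∀ b, avgK s b g * (stdW1 s b * testH s b) = Set.indicator {b : TreeV | b <+: g}
      (fun b => 2 ^ (-((1 - s) / 2) * ((g.length - b.length : ℕ) : ℝ))
        * (stdW1 s g * testH s g)) b := fun b => by
    by_cases h : b <+: g
    · rw [Set.indicator_of_mem (by exact h), avgK, if_pos h]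
      simp only [stdW1, testH, dT, ← two_rpow_add]
      congr 1
      push_cast [Nat.cast_sub h.length_le]
      ring
    · rw [Set.indicator_of_notMem (by exact h), avgK, if_neg h, zero_mul]
  rw [tsum_congr h1, ← tsum_subtype, ENNReal.tsum_mul_right]
  gcongr
  have hinj : Function.Injective
      (fun b : {b : TreeV | b <+: g} => g.length - (b : TreeV).length) := by
    rintro ⟨b, hb⟩ ⟨c, hc⟩ h
    have hb' : b <+: g := hb
    have hc' : c <+: g := hc
    have h1 := hb'.length_le
    have h2 := hc'.length_le
    simp only at h
    exact Subtype.ext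
      ((List.prefix_of_prefix_length_le hb' hc' (by omega)).eq_of_length (by omega))
  exact ENNReal.tsum_comp_le_tsum_of_injective hinj
    (fun n : ℕ => (2 : ℝ≥0∞) ^ (-((1 - s) / 2) * (n : ℝ)))

theorem stdW_eq (d : ℕ) (s : Fin d → ℝ) (β : VtxD d) : stdW d s β = ∏ j, stdW1 (s j) (β j) := rfl

/-- The averaging operator over descendants is bounded on `ℓ²(π)`. -/
theorem energy_avg_le (d : ℕ) (s : Fin d → ℝ) (f : VtxD d → ℝ≥0∞) :
    ∑' b : VtxD d, (∑' g : VtxD d, (∏ j, avgK (s j) (b j) (g j)) * f g) ^ 2 * stdW d s b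
      ≤ (∏ j, geomC ((1 - s j) / 2)) * (∏ j, geomC ((1 - s j) / 2))
        * ∑' g, f g ^ 2 * stdW d s g := by
  refine ENNReal.schur_test (stdW d s) (fun b => ∏ j, testH (s j) (b j))
    (fun b g => ∏ j, avgK (s j) (b j) (g j)) _ _ ?_ ?_ ?_ ?_ f
  · intro b
    exact Finset.prod_ne_zero_iff.2 fun j _ => (ENNReal.rpow_pos (by norm_num) (by norm_num)).ne'
  · intro b
    exact ENNReal.prod_ne_top fun j _ => ENNReal.rpow_ne_top_of_ne_zero (by norm_num) (by norm_num)
  · intro b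
    simp_rw [← Finset.prod_mul_distrib]
    rw [ENNReal.tsum_pi_prod d fun j g => avgK (s j) (b j) g * testH (s j) g]
    exact Finset.prod_le_prod' fun j _ => tsum_avgK_right (s j) (b j)
  · intro g
    simp_rw [stdW_eq, ← Finset.prod_mul_distrib]
    rw [ENNReal.tsum_pi_prod d
      fun j b => avgK (s j) b (g j) * (stdW1 (s j) b * testH (s j) b)]
    exact Finset.prod_le_prod' fun j _ => tsum_avgK_left (s j) (g j)

/-- The fair coin-tossing measure on `∂T`. -/
def coinM : Measure TreeB := Measure.infinitePi fun _ => (PMF.uniformOfFintype Bool).toMeasure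

instance : IsProbabilityMeasure coinM := by unfold coinM; infer_instance

/-- The boundary point below `τ` whose digits not prescribed by `τ` are those of `x`. -/
def glue : TreeBar → TreeB → TreeB
  | Sum.inl b, x => fun n => (b[n]?).getD (x n)
  | Sum.inr ω, _ => ω

theorem ancOf_glue (τ : TreeBar) (x : TreeB) : ancOf (Sum.inr (glue τ x)) τ := by
  cases τ with
  | inl b => intro i; simp [glue]
  | inr ω => rfl

theorem measurableSet_glue (τ : TreeBar) (g : TreeV) :
    MeasurableSet {x | ancOf (Sum.inr (glue τ x)) (Sum.inl g)} := by
  have hm : ∀ n, Measurable fun x => glue τ x n := by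
    intro n
    cases τ with
    | inl b =>
      cases h : b[n]? with
      | none => simpa [glue, h] using measurable_pi_apply n
      | some c => simp [glue, h]
    | inr ω => simp [glue]
  simp only [ancOf, Set.ofPred_forall]
  exact MeasurableSet.iInter fun i => measurableSet_eq_fun measurable_const (hm _)

theorem coinM_glue_le (τ : TreeBar) (s : ℝ) (g : TreeV) :
    stdW1 s g * coinM {x | ancOf (Sum.inr (glue τ x)) (Sum.inl g)}
      ≤ ∑' b, Set.indicator {b : TreeV | ancOf τ (Sum.inl b)}
          (fun b => stdW1 s b * avgK s b g) b := by
  by_cases hg : ancOf τ (Sum.inl g)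
  · refine le_trans ?_ (ENNReal.le_tsum g)
    rw [Set.indicator_of_mem (by exact hg), avgK, if_pos (List.prefix_refl g)]
    gcongr
    simpa using prob_le_one
  rcases Set.eq_empty_or_nonempty {x | ancOf (Sum.inr (glue τ x)) (Sum.inl g)} with he | ⟨x, hx⟩
  · simp [he]
  cases τ with
  | inr ω => exact absurd hx hg
  | inl b =>
    have hx' : ∀ i : Fin g.length, g.get i = (b[(i : ℕ)]?).getD (x i) := hx
    have hagree : ∀ i (h1 : i < g.length) (h2 : i < b.length), g[i] = b[i] := by
      intro i h1 h2
      simpa [h2] using hx' ⟨i, h1⟩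
    have hbg : b <+: g := by
      rcases le_total g.length b.length with h | h
      · refine absurd ?_ hg
        change g <+: b
        rw [List.prefix_iff_eq_take]
        refine List.ext_getElem (by simp [h]) fun i h1 h2 => ?_
        rw [List.getElem_take]
        exact hagree i h1 (by omega)
      · rw [List.prefix_iff_eq_take]
        refine List.ext_getElem (by simp [h]) fun i h1 h2 => ?_
        rw [List.getElem_take]
        exact (hagree i (by omega) h1).symm
    refine le_trans ?_ (ENNReal.le_tsum b)
    rw [Set.indicator_of_mem (by exact List.prefix_refl b), avgK, if_pos hbg]
    have hsub : {y | ancOf (Sum.inr (glue (Sum.inl b) y)) (Sum.inl g)} ⊆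
        Set.pi (Finset.Ico b.length g.length : Finset ℕ) fun i => {g.getD i false} := by
      intro y hy i hi
      have hy' : ∀ i : Fin g.length, g.get i = (b[(i : ℕ)]?).getD (y i) := hy
      simp only [Finset.coe_Ico, Set.mem_Ico] at hi
      have := hy' ⟨i, hi.2⟩
      rw [List.getElem?_eq_none (by simpa using hi.1)] at this
      simp only [List.get_eq_getElem, Option.getD_none] at this
      simp [hi.2, this]
    have hle : coinM {y | ancOf (Sum.inr (glue (Sum.inl b) y)) (Sum.inl g)}
        ≤ 2 ^ (-((g.length : ℝ) - b.length)) := by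
      refine (measure_mono hsub).trans (le_of_eq ?_)
      rw [coinM, Measure.infinitePi_pi]
      · have : ∀ i : ℕ, (PMF.uniformOfFintype Bool).toMeasure {g.getD i false} = 2⁻¹ := by
          intro i
          rw [PMF.toMeasure_apply_singleton _ _ (measurableSet_singleton _)]
          simp
        rw [Finset.prod_congr rfl fun i _ => this i, Finset.prod_const, Nat.card_Ico,
          ← ENNReal.rpow_natCast, Nat.cast_sub hbg.length_le, ENNReal.inv_rpow, ENNReal.rpow_neg]
      · exact fun i _ => measurableSet_singleton _
    refine (mul_le_mul_right hle _).trans (le_of_eq ?_)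
    simp only [stdW1, dT, ← two_rpow_add]
    congr 1
    push_cast
    ring

theorem ancOf_trans {a b : TreeBar} {c : TreeV} (h : ancOf a b) (hb : ancOf b (Sum.inl c)) :
    ancOf a (Sum.inl c) := by
  rcases a with a | a <;> rcases b with b | b
  · exact List.IsPrefix.trans hb h
  · exact h.elim
  · obtain ⟨l, rfl⟩ : c <+: b := hb
    intro i
    have := h ⟨i, by simp; omega⟩
    simpa [List.getElem_append_left] using this
  · cases (show a = b from h)
    exact hb

theorem hardy_anti {d : ℕ} (π f : VtxD d → ℝ≥0∞) {α β : BarD d}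
    (h : ∀ i, ancOf (α i) (β i)) : hardy π f β ≤ hardy π f α :=
  ENNReal.tsum_le_tsum fun _ => Set.indicator_le_indicator_apply_of_subset
    (fun _ hγ i => ancOf_trans (h i) (hγ i)) zero_le

/-- If the Hardy operator of `f` is at least `1` on the boundary successors of `τ`, then the Hardy
operator of the descendant average of `f` is at least `1` at `τ`. -/
theorem one_le_hardy_avg (d : ℕ) (s : Fin d → ℝ) (f : VtxD d → ℝ≥0∞) (τ : BarD d)
    (h : ∀ x : BndD d, 1 ≤ hardy (stdW d s) f (bEmb fun i => glue (τ i) (x i))) :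
    1 ≤ hardy (stdW d s) (fun b => ∑' g : VtxD d, (∏ j, avgK (s j) (b j) (g j)) * f g) τ := by
  set P : Measure (BndD d) := Measure.pi fun _ => coinM
  let A : VtxD d → Set (BndD d) := fun γ =>
    Set.pi univ fun j => {x | ancOf (Sum.inr (glue (τ j) x)) (Sum.inl (γ j))}
  have hA : ∀ γ, MeasurableSet (A γ) := fun γ =>
    MeasurableSet.univ_pi fun j => measurableSet_glue (τ j) (γ j)
  calc (1 : ℝ≥0∞) = ∫⁻ _ : BndD d, 1 ∂P := by simp [P]
    _ ≤ ∫⁻ x, hardy (stdW d s) f (bEmb fun i => glue (τ i) (x i)) ∂P := lintegral_mono h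
    _ = ∫⁻ x, ∑' γ, (A γ).indicator (fun _ => f γ * stdW d s γ) x ∂P := by
        refine lintegral_congr fun x => tsum_congr fun γ => ?_
        simp only [Set.indicator_apply, A, vleOf, bEmb, Set.mem_pi, Set.mem_ofPred_eq, Set.mem_univ,
          true_imp_iff]
    _ = ∑' γ, f γ * (stdW d s γ * P (A γ)) := by
        rw [lintegral_tsum fun γ => (measurable_const.indicator (hA γ)).aemeasurable]
        refine tsum_congr fun γ => ?_
        rw [lintegral_indicator_const (hA γ), mul_assoc]
    _ ≤ ∑' γ, f γ * ∏ j, ∑' b, Set.indicator {b : TreeV | ancOf (τ j) (Sum.inl b)}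
          (fun b => stdW1 (s j) b * avgK (s j) b (γ j)) b := by
        refine ENNReal.tsum_le_tsum fun γ => ?_
        rw [Measure.pi_pi, stdW_eq, ← Finset.prod_mul_distrib]
        gcongr with j
        exact coinM_glue_le (τ j) (s j) (γ j)
    _ = hardy (stdW d s) (fun b => ∑' g : VtxD d, (∏ j, avgK (s j) (b j) (g j)) * f g) τ := by
        have : ∀ γ : VtxD d, (∏ j, ∑' b, Set.indicator {b : TreeV | ancOf (τ j) (Sum.inl b)}
            (fun b => stdW1 (s j) b * avgK (s j) b (γ j)) b)
            = ∑' b : VtxD d, Set.indicator {b : VtxD d | vleOf τ b}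
              (fun b => stdW d s b * ∏ j, avgK (s j) (b j) (γ j)) b := by
          intro γ
          rw [← ENNReal.tsum_pi_prod d fun j b => Set.indicator {b : TreeV | ancOf (τ j) (Sum.inl b)}
            (fun b => stdW1 (s j) b * avgK (s j) b (γ j)) b]
          refine tsum_congr fun b => ?_
          by_cases hb : vleOf τ b
          · rw [Set.indicator_of_mem (by exact hb), stdW_eq, ← Finset.prod_mul_distrib]
            exact Finset.prod_congr rfl fun j _ => Set.indicator_of_mem (by exact hb j) _
          · rw [Set.indicator_of_notMem (by exact hb)]
            obtain ⟨j, hj⟩ := not_forall.1 hb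
            exact Finset.prod_eq_zero (Finset.mem_univ j) (Set.indicator_of_notMem (by exact hj) _)
        simp_rw [this, hardy, ← ENNReal.tsum_mul_left]
        rw [ENNReal.tsum_comm]
        refine tsum_congr fun b => ?_
        by_cases hb : vleOf τ b
        · simp only [Set.indicator_of_mem (show b ∈ {b : VtxD d | vleOf τ b} from hb)]
          rw [← ENNReal.tsum_mul_right]
          exact tsum_congr fun g => by ring
        · simp [Set.indicator_of_notMem (show b ∉ {b : VtxD d | vleOf τ b} from hb)]

/-- Corollary 1: for a standard polynomial product weight and compact
`E ⊆ T̄^d`, `cap_π S_b(E) ≤ cap_π E ≤ C · cap_π S_b(E)` with `C > 1` depending only on `d`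
and `s_1, …, s_d`. -/
theorem statement10 (d : ℕ) (s : Fin d → ℝ) (hs0 : ∀ j, 0 ≤ s j) (hs1 : ∀ j, s j < 1) :
    (∀ E : Set (BarD d), IsCompact E →
        capac (stdW d s) (sbProj E) ≤ capac (stdW d s) E) ∧
    ∃ C : ℝ≥0∞, 1 < C ∧ C ≠ ⊤ ∧
      ∀ E : Set (BarD d), IsCompact E →
        capac (stdW d s) E ≤ C * capac (stdW d s) (sbProj E) := by
  refine ⟨fun E _ => ?_, ?_⟩
  · refine le_iInf₂ fun f hf => iInf₂_le f ?_
    rintro α ⟨-, β, hβ, hαβ⟩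
    exact (hf β hβ).trans (hardy_anti _ _ hαβ)
  set G : ℝ≥0∞ := (∏ j, geomC ((1 - s j) / 2)) * ∏ j, geomC ((1 - s j) / 2) with hG
  have hGt : G ≠ ⊤ := by
    have : ∏ j, geomC ((1 - s j) / 2) ≠ ⊤ :=
      ENNReal.prod_ne_top fun j _ => geomC_ne_top (by linarith [hs1 j])
    exact ENNReal.mul_ne_top this this
  refine ⟨2 + G, lt_of_lt_of_le (by norm_num) le_self_add, by simp [hGt], fun E _ => ?_⟩
  have h0 : 2 + G ≠ 0 := by simp
  have ht : 2 + G ≠ ⊤ := by simp [hGt]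
  rw [mul_comm, ← ENNReal.div_le_iff h0 ht]
  refine le_iInf₂ fun f hf => ?_
  rw [ENNReal.div_le_iff h0 ht, mul_comm]
  refine (iInf₂_le _ fun τ hτ => one_le_hardy_avg d s f τ fun x => hf _ ?_).trans
    ((energy_avg_le d s f).trans (mul_le_mul_left le_add_self _))
  exact ⟨fun i => ⟨_, rfl⟩, τ, hτ, fun i => ancOf_glue (τ i) (x i)⟩
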